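/- arXiv:math/0501382 — 3 statements merged into one kernel-verified Lean document; each statement's English description precedes it below -/
import Mathlib

section
/- There exist constants C, C₁, C₂ > 0 and a sequence ε_n ≥ 0 with ε_n → 0 as n → ∞ such that for every n ≥ 4 and every t with 0 < t < C·√n one has (1 - ε_n)·(1 - Φ(t))·exp(-t⁴/(C₂·n)) ≤ 1 - Ψ_n(t) ≤ (1 + ε_n)·(1 - Φ(t))·exp(-t⁴/(C₁·n)). -/
open MeasureTheory Real Filter

/-- The standard Gaussian density `φ(t) = (2π)^{-1/2} e^{-t²/2}`. -/
noncomputable def gaussDensity (t : ℝ) : ℝ := Real.exp (-t ^ 2 / 2) / Real.sqrt (2 * Real.pi)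

/-- The standard Gaussian distribution function `Φ(t) = ∫_{-∞}^t φ(s) ds`. -/
noncomputable def gaussCDF (t : ℝ) : ℝ := ∫ s in Set.Iic t, gaussDensity s

/-- The spherical density `ψ_n`. -/
noncomputable def sphDensity (n : ℕ) (t : ℝ) : ℝ :=
  if |t| ≤ Real.sqrt n then
    (Real.sqrt (Real.pi * n))⁻¹ * (Real.Gamma ((n : ℝ) / 2) / Real.Gamma (((n : ℝ) - 1) / 2)) *
      (1 - t ^ 2 / (n : ℝ)) ^ (((n : ℝ) - 3) / 2)
  else 0

/-- The spherical distribution function `Ψ_n(t) = ∫_{-∞}^t ψ_n(s) ds`. -/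
noncomputable def sphCDF (n : ℕ) (t : ℝ) : ℝ := ∫ s in Set.Iic t, sphDensity n s

lemma one_sub_integral_Iic {f : ℝ → ℝ} (hf : Integrable f) (h1 : ∫ x, f x = 1) (t : ℝ) :
    1 - ∫ s in Set.Iic t, f s = ∫ s in Set.Ioi t, f s := by
  rw [← h1, ← intervalIntegral.integral_Iic_add_Ioi (b := t) hf.integrableOn hf.integrableOn]
  ring

lemma gaussDensity_eq (t : ℝ) :
    gaussDensity t = (√(2 * π))⁻¹ * rexp (-(1 / 2) * t ^ 2) := by
  rw [gaussDensity, div_eq_inv_mul]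
  congr 2
  ring

lemma gaussDensity_pos (t : ℝ) : 0 < gaussDensity t := by
  unfold gaussDensity
  positivity

lemma continuous_gaussDensity : Continuous gaussDensity := by
  unfold gaussDensity
  fun_prop

lemma integrable_gaussDensity : Integrable gaussDensity := by
  rw [funext gaussDensity_eq]
  exact (integrable_exp_neg_mul_sq (by norm_num)).const_mul _

lemma integral_gaussDensity : ∫ x, gaussDensity x = 1 := by
  rw [funext gaussDensity_eq, integral_const_mul, integral_gaussian]
  rw [show π / (1 / 2) = 2 * π by ring]
  exact inv_mul_cancel₀ (by positivity)

lemma one_sub_gaussCDF (t : ℝ) : 1 - gaussCDF t = ∫ s in Set.Ioi t, gaussDensity s :=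
  one_sub_integral_Iic integrable_gaussDensity integral_gaussDensity t

lemma one_sub_gaussCDF_nonneg (t : ℝ) : 0 ≤ 1 - gaussCDF t := by
  rw [one_sub_gaussCDF]
  exact integral_nonneg fun s => (gaussDensity_pos s).le

lemma hasDerivAt_gaussCDF (t : ℝ) : HasDerivAt gaussCDF (gaussDensity t) t := by
  have h : gaussCDF = fun u => gaussCDF 0 + ∫ s in (0 : ℝ)..u, gaussDensity s := by
    funext u
    rw [← intervalIntegral.integral_Iic_sub_Iic integrable_gaussDensity.integrableOn
      integrable_gaussDensity.integrableOn]
    simp [gaussCDF]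
  rw [h]
  exact (continuous_gaussDensity.integral_hasStrictDerivAt 0 t).hasDerivAt.const_add _

lemma gaussCDF_mono : Monotone gaussCDF :=
  monotone_of_hasDerivAt_nonneg hasDerivAt_gaussCDF fun t => (gaussDensity_pos t).le

lemma hasDerivAt_gaussDensity (t : ℝ) : HasDerivAt gaussDensity (-t * gaussDensity t) t := by
  have h : HasDerivAt (fun x : ℝ => -x ^ 2 / 2) (-t) t := by
    convert! ((hasDerivAt_pow 2 t).neg.div_const 2) using 1
    simp
    ring
  convert! h.exp.div_const (√(2 * π)) using 1
  unfold gaussDensity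
  ring

/-- The upper Mills ratio bound for the Gaussian tail. -/
lemma mul_one_sub_gaussCDF_le (t : ℝ) : t * (1 - gaussCDF t) ≤ gaussDensity t := by
  have h_int : Integrable fun s : ℝ => s * gaussDensity s := by
    convert! (integrable_mul_exp_neg_mul_sq (b := 1 / 2) (by norm_num)).const_mul
      (√(2 * π))⁻¹ using 1
    funext s
    rw [gaussDensity_eq]
    ring
  have hlim : Tendsto gaussDensity atTop (nhds 0) := by
    have h : Tendsto (fun x : ℝ => -x ^ 2 / 2) atTop atBot := by
      have := (tendsto_pow_atTop (α := ℝ) (two_ne_zero)).atTop_div_const (zero_lt_two (α := ℝ))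
      refine (tendsto_neg_atTop_atBot.comp this).congr fun x => ?_
      simp only [Function.comp]
      ring
    have := (tendsto_exp_atBot.comp h).div_const (√(2 * π))
    rw [zero_div] at this
    exact this
  have hval : ∫ s in Set.Ioi t, s * gaussDensity s = gaussDensity t := by
    have := integral_Ioi_of_hasDerivAt_of_tendsto' (a := t) (f := fun s => -gaussDensity s)
      (f' := fun s => s * gaussDensity s) (m := 0)
      (fun s _ => by
        convert! (hasDerivAt_gaussDensity s).neg using 1
        ring) h_int.integrableOn (by simpa using hlim.neg)
    simpa using this
  rw [one_sub_gaussCDF, ← hval, ← integral_const_mul]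
  refine setIntegral_mono_on (integrable_gaussDensity.const_mul t).integrableOn
    h_int.integrableOn measurableSet_Ioi fun s hs => ?_
  exact mul_le_mul_of_nonneg_right (le_of_lt hs) (gaussDensity_pos s).le

/-- The midpoint case of the log-convexity of the Gamma function. -/
lemma sq_Gamma_add_half_le {x : ℝ} (hx : 0 < x) :
    Real.Gamma (x + 1 / 2) ^ 2 ≤ x * Real.Gamma x ^ 2 := by
  have hG := Real.Gamma_pos_of_pos hx
  have h := Real.Gamma_mul_add_mul_le_rpow_Gamma_mul_rpow_Gamma hx (add_pos hx one_pos)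
    (a := 1 / 2) (b := 1 / 2) (by norm_num) (by norm_num) (by norm_num)
  rw [show 1 / 2 * x + 1 / 2 * (x + 1) = x + 1 / 2 by ring, Real.Gamma_add_one hx.ne',
    ← Real.sqrt_eq_rpow, ← Real.sqrt_eq_rpow, ← Real.sqrt_mul hG.le,
    show Real.Gamma x * (x * Real.Gamma x) = x * Real.Gamma x ^ 2 by ring] at h
  have h0 : 0 ≤ Real.Gamma (x + 1 / 2) := (Real.Gamma_pos_of_pos (by positivity)).le
  calc Real.Gamma (x + 1 / 2) ^ 2 ≤ √(x * Real.Gamma x ^ 2) ^ 2 := by gcongr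
    _ = _ := Real.sq_sqrt (by positivity)

/-- The normalizing constant of the spherical density. -/
noncomputable def sphConst (n : ℕ) : ℝ :=
  (√(π * n))⁻¹ * (Real.Gamma ((n : ℝ) / 2) / Real.Gamma (((n : ℝ) - 1) / 2))

lemma sphConst_pos {n : ℕ} (hn : 4 ≤ n) : 0 < sphConst n := by
  have hn' : (4 : ℝ) ≤ n := by exact_mod_cast hn
  have h1 := Real.Gamma_pos_of_pos (show 0 < (n : ℝ) / 2 by linarith)
  have h2 := Real.Gamma_pos_of_pos (show 0 < ((n : ℝ) - 1) / 2 by linarith)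
  unfold sphConst
  positivity

lemma sphConst_mul_sq_bounds {n : ℕ} (hn : 4 ≤ n) :
    1 - 2 / (n : ℝ) ≤ (sphConst n * √(2 * π)) ^ 2 ∧ (sphConst n * √(2 * π)) ^ 2 ≤ 1 := by
  have hn' : (4 : ℝ) ≤ n := by exact_mod_cast hn
  have h1 := Real.Gamma_pos_of_pos (show 0 < (n : ℝ) / 2 by linarith)
  have h2 := Real.Gamma_pos_of_pos (show 0 < ((n : ℝ) - 1) / 2 by linarith)
  have hu := sq_Gamma_add_half_le (show 0 < ((n : ℝ) - 1) / 2 by linarith)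
  have hl := sq_Gamma_add_half_le (show 0 < ((n : ℝ) - 2) / 2 by linarith)
  have hr := Real.Gamma_add_one (show ((n : ℝ) - 2) / 2 ≠ 0 by linarith)
  rw [show ((n : ℝ) - 1) / 2 + 1 / 2 = n / 2 by ring] at hu
  rw [show ((n : ℝ) - 2) / 2 + 1 / 2 = (n - 1) / 2 by ring] at hl
  rw [show ((n : ℝ) - 2) / 2 + 1 = n / 2 by ring] at hr
  have hl' : Real.Gamma (((n : ℝ) - 1) / 2) ^ 2 * ((n - 2) / 2) ≤ Real.Gamma ((n : ℝ) / 2) ^ 2 := by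
    rw [hr]
    nlinarith
  have hsq : (sphConst n * √(2 * π)) ^ 2 =
      2 * Real.Gamma ((n : ℝ) / 2) ^ 2 / (n * Real.Gamma (((n : ℝ) - 1) / 2) ^ 2) := by
    rw [sphConst, mul_pow, mul_pow, inv_pow, Real.sq_sqrt (by positivity),
      Real.sq_sqrt (by positivity)]
    field_simp
  rw [hsq]
  constructor
  · rw [le_div_iff₀ (by positivity), ← mul_assoc, sub_mul, div_mul_cancel₀ _ (by linarith)]
    nlinarith
  · rw [div_le_one (by positivity)]
    nlinarith [sq_nonneg (Real.Gamma (((n : ℝ) - 1) / 2))]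

lemma sphConst_le {n : ℕ} (hn : 4 ≤ n) : sphConst n ≤ (√(2 * π))⁻¹ := by
  have hs : 0 < √(2 * π) := by positivity
  rw [← one_div, le_div_iff₀ hs]
  exact (sq_le_one_iff₀ (mul_pos (sphConst_pos hn) hs).le).1 (sphConst_mul_sq_bounds hn).2

lemma le_sphConst {n : ℕ} (hn : 4 ≤ n) : (1 - 2 / (n : ℝ)) * (√(2 * π))⁻¹ ≤ sphConst n := by
  have hs : 0 < √(2 * π) := by positivity
  rw [← div_eq_mul_inv, div_le_iff₀ hs]
  have h := mul_pos (sphConst_pos hn) hs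
  have hb := sphConst_mul_sq_bounds hn
  have h1 := (sq_le_one_iff₀ h.le).1 hb.2
  nlinarith

lemma log_one_sub_le {x : ℝ} (h0 : 0 ≤ x) (h1 : x < 1) : Real.log (1 - x) ≤ -x - x ^ 2 / 2 := by
  have h := sum_le_hasSum (Finset.range 2) (fun i _ => by positivity)
    (Real.hasSum_pow_div_log_of_abs_lt_one (abs_lt.2 ⟨by linarith, h1⟩))
  norm_num [Finset.sum_range_succ] at h
  linarith

lemma le_log_one_sub {x : ℝ} (h0 : 0 ≤ x) (h1 : x ≤ 1 / 4) : -x - x ^ 2 ≤ Real.log (1 - x) := by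
  have h := Real.abs_log_sub_add_sum_range_le (x := x) (abs_lt.2 ⟨by linarith, by linarith⟩) 2
  rw [abs_of_nonneg h0] at h
  norm_num [Finset.sum_range_succ] at h
  have h2 : x ^ 3 / (1 - x) ≤ x ^ 2 / 2 := by
    rw [div_le_iff₀ (by linarith)]
    nlinarith [sq_nonneg x]
  have := (abs_le.1 h).1
  linarith

lemma sphDensity_of_abs_le {n : ℕ} {s : ℝ} (hs : |s| ≤ √n) :
    sphDensity n s = sphConst n * (1 - s ^ 2 / (n : ℝ)) ^ (((n : ℝ) - 3) / 2) :=
  if_pos hs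

/-- The spherical density is a rescaled density of a symmetric beta distribution. -/
lemma sphDensity_eq_betaPDFReal {n : ℕ} (hn : 4 ≤ n) (s : ℝ) :
    sphDensity n s = (2 * √n)⁻¹ * ProbabilityTheory.betaPDFReal (((n : ℝ) - 1) / 2)
      (((n : ℝ) - 1) / 2) ((2 * √n)⁻¹ * s + 1 / 2) := by
  have hn' : (4 : ℝ) ≤ n := by exact_mod_cast hn
  have hr : 0 < √(n : ℝ) := by positivity
  have hr2 : √(n : ℝ) ^ 2 = n := Real.sq_sqrt (by positivity)
  set u := (2 * √(n : ℝ))⁻¹ * s + 1 / 2 with hu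
  have hu_pos : 0 < u ↔ -√(n : ℝ) < s := by
    rw [hu, show (2 * √(n : ℝ))⁻¹ * s + 1 / 2 = (s + √(n : ℝ)) / (2 * √(n : ℝ)) by field_simp,
      div_pos_iff_of_pos_right (by positivity)]
    constructor <;> intro h <;> linarith
  have hu_lt : u < 1 ↔ s < √(n : ℝ) := by
    rw [hu, show (2 * √(n : ℝ))⁻¹ * s + 1 / 2 = (s + √(n : ℝ)) / (2 * √(n : ℝ)) by field_simp,
      div_lt_one (by positivity)]
    constructor <;> intro h <;> linarith
  simp only [ProbabilityTheory.betaPDFReal, hu_pos, hu_lt, ← abs_lt]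
  rcases lt_trichotomy |s| √(n : ℝ) with h | h | h
  · have hu0 := hu_pos.2 (abs_lt.1 h).1
    have hu1 := hu_lt.2 (abs_lt.1 h).2
    rw [sphDensity_of_abs_le h.le, if_pos h, mul_assoc,
      ← Real.mul_rpow hu0.le (by linarith)]
    have huu : u * (1 - u) = (1 - s ^ 2 / n) / 4 := by
      rw [hu, show s ^ 2 / (n : ℝ) = s ^ 2 / √(n : ℝ) ^ 2 by rw [hr2]]
      field_simp
      ring
    have hpos : 0 ≤ 1 - s ^ 2 / (n : ℝ) := by nlinarith
    rw [huu, Real.div_rpow hpos (by norm_num),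
      show ((n : ℝ) - 1) / 2 - 1 = ((n : ℝ) - 3) / 2 by ring]
    have hm : 0 < ((n : ℝ) - 1) / 2 := by linarith
    have hG := Real.Gamma_pos_of_pos hm
    have hG2 := Real.Gamma_pos_of_pos (mul_pos two_pos hm)
    have hdup := Real.Gamma_mul_Gamma_add_half (((n : ℝ) - 1) / 2)
    rw [show ((n : ℝ) - 1) / 2 + 1 / 2 = n / 2 by ring] at hdup
    have h4 : (4 : ℝ) ^ (((n : ℝ) - 3) / 2) * (2 * 2 ^ (1 - 2 * (((n : ℝ) - 1) / 2))) = 1 := by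
      rw [show (4 : ℝ) = 2 ^ (2 : ℝ) by norm_num, ← Real.rpow_mul (by norm_num)]
      rw [mul_left_comm, ← Real.rpow_add two_pos,
        show 2 * (((n : ℝ) - 3) / 2) + (1 - 2 * (((n : ℝ) - 1) / 2)) = -1 by ring,
        Real.rpow_neg_one]
      norm_num
    have hpow : (2 : ℝ) ^ (1 - 2 * (((n : ℝ) - 1) / 2)) = (2 * 4 ^ (((n : ℝ) - 3) / 2))⁻¹ := by
      refine eq_inv_of_mul_eq_one_left ?_
      linarith
    rw [hpow] at hdup
    have hΓ : Real.Gamma ((n : ℝ) / 2) = Real.Gamma (2 * (((n : ℝ) - 1) / 2)) *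
        (2 * 4 ^ (((n : ℝ) - 3) / 2))⁻¹ * √π / Real.Gamma (((n : ℝ) - 1) / 2) := by
      rw [eq_div_iff hG.ne', ← hdup]
      ring
    rw [sphConst, ProbabilityTheory.beta, hΓ, Real.sqrt_mul pi_pos.le, ← two_mul]
    have hπ : 0 < √π := by positivity
    field_simp
  · rw [sphDensity_of_abs_le h.le, if_neg h.not_lt, ← sq_abs, h, hr2,
      div_self (by linarith), sub_self, Real.zero_rpow (by linarith)]
    simp
  · rw [sphDensity, if_neg h.not_ge, if_neg h.le.not_gt, mul_zero]

lemma integrable_betaPDFReal {α β : ℝ} (hα : 0 < α) (hβ : 0 < β) :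
    Integrable (ProbabilityTheory.betaPDFReal α β) := by
  refine ⟨(ProbabilityTheory.stronglyMeasurable_betaPDFReal α β).aestronglyMeasurable, ?_⟩
  rw [hasFiniteIntegral_iff_ofReal (ae_of_all _ fun x => ?_)]
  · have := ProbabilityTheory.lintegral_betaPDF_eq_one hα hβ
    unfold ProbabilityTheory.betaPDF at this
    rw [this]
    exact ENNReal.one_lt_top
  · by_cases h : 0 < x ∧ x < 1
    · exact (ProbabilityTheory.betaPDFReal_pos h.1 h.2 hα hβ).le
    · simp [ProbabilityTheory.betaPDFReal, h]

lemma integral_betaPDFReal {α β : ℝ} (hα : 0 < α) (hβ : 0 < β) :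
    ∫ x, ProbabilityTheory.betaPDFReal α β x = 1 := by
  rw [integral_eq_lintegral_of_nonneg_ae (ae_of_all _ fun x => ?_)
    (ProbabilityTheory.stronglyMeasurable_betaPDFReal α β).aestronglyMeasurable]
  · have := ProbabilityTheory.lintegral_betaPDF_eq_one hα hβ
    unfold ProbabilityTheory.betaPDF at this
    rw [this, ENNReal.toReal_one]
  · by_cases h : 0 < x ∧ x < 1
    · exact (ProbabilityTheory.betaPDFReal_pos h.1 h.2 hα hβ).le
    · simp [ProbabilityTheory.betaPDFReal, h]

lemma integrable_sphDensity {n : ℕ} (hn : 4 ≤ n) : Integrable (sphDensity n) := by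
  have hn' : (4 : ℝ) ≤ n := by exact_mod_cast hn
  have hm : 0 < ((n : ℝ) - 1) / 2 := by linarith
  have hr : 0 < √(n : ℝ) := by positivity
  rw [funext (sphDensity_eq_betaPDFReal hn)]
  exact (((integrable_betaPDFReal hm hm).comp_add_right (1 / 2)).comp_mul_left'
    (by positivity)).const_mul _

lemma integral_sphDensity {n : ℕ} (hn : 4 ≤ n) : ∫ x, sphDensity n x = 1 := by
  have hn' : (4 : ℝ) ≤ n := by exact_mod_cast hn
  have hm : 0 < ((n : ℝ) - 1) / 2 := by linarith
  have hr : 0 < √(n : ℝ) := by positivity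
  rw [funext (sphDensity_eq_betaPDFReal hn), integral_const_mul,
    Measure.integral_comp_mul_left (fun x => ProbabilityTheory.betaPDFReal (((n : ℝ) - 1) / 2)
      (((n : ℝ) - 1) / 2) (x + 1 / 2)),
    integral_add_right_eq_self (ProbabilityTheory.betaPDFReal _ _), integral_betaPDFReal hm hm,
    inv_inv, abs_of_pos (by positivity), smul_eq_mul, mul_one]
  exact inv_mul_cancel₀ (by positivity)

lemma one_sub_sphCDF {n : ℕ} (hn : 4 ≤ n) (t : ℝ) :
    1 - sphCDF n t = ∫ s in Set.Ioi t, sphDensity n s :=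
  one_sub_integral_Iic (integrable_sphDensity hn) (integral_sphDensity hn) t

lemma sphDensity_nonneg {n : ℕ} (hn : 4 ≤ n) (s : ℝ) : 0 ≤ sphDensity n s := by
  have hn' : (4 : ℝ) ≤ n := by exact_mod_cast hn
  by_cases h : |s| ≤ √(n : ℝ)
  · rw [sphDensity_of_abs_le h]
    have h2 : s ^ 2 ≤ n := by rwa [Real.le_sqrt (abs_nonneg s) (by positivity), sq_abs] at h
    have h3 : s ^ 2 / (n : ℝ) ≤ 1 := div_le_one_of_le₀ h2 (by positivity)
    exact mul_nonneg (sphConst_pos hn).le (Real.rpow_nonneg (by linarith) _)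
  · rw [sphDensity, if_neg h]

lemma sphDensity_le {n : ℕ} (hn : 4 ≤ n) {s : ℝ} :
    sphDensity n s ≤ rexp (18 / n) * rexp (-s ^ 4 / (32 * n)) * gaussDensity s := by
  have hn' : (4 : ℝ) ≤ n := by exact_mod_cast hn
  rcases lt_or_ge (s ^ 2) (n : ℝ) with h | h
  · have hx1 : s ^ 2 / (n : ℝ) < 1 := (div_lt_one (by linarith)).2 h
    rw [sphDensity_of_abs_le (Real.abs_le_sqrt h.le), gaussDensity_eq,
      Real.rpow_def_of_pos (by linarith), mul_left_comm, ← Real.exp_add, ← Real.exp_add]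
    refine mul_le_mul (sphConst_le hn) (Real.exp_le_exp.2 ?_) (Real.exp_pos _).le (by positivity)
    have hlog := log_one_sub_le (x := s ^ 2 / n) (by positivity) hx1
    have h3 := mul_le_mul_of_nonneg_right hlog (show 0 ≤ ((n : ℝ) - 3) / 2 by linarith)
    refine h3.trans ?_
    have key : 18 / (n : ℝ) + -s ^ 4 / (32 * n) + -(1 / 2) * s ^ 2 -
        (-(s ^ 2 / n) - (s ^ 2 / n) ^ 2 / 2) * ((n - 3) / 2) =
        ((s ^ 2 - 24) ^ 2 / (32 * n) + s ^ 4 * (3 * (n - 4)) / (16 * n ^ 2)) := by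
      field_simp
      ring
    have : 0 ≤ (s ^ 2 - 24) ^ 2 / (32 * n) + s ^ 4 * (3 * (n - 4)) / (16 * (n : ℝ) ^ 2) := by
      have : 0 ≤ (n : ℝ) - 4 := by linarith
      positivity
    linarith
  · have h0 : sphDensity n s = 0 := by
      rcases h.eq_or_lt with h | h
      · rw [sphDensity_of_abs_le (Real.abs_le_sqrt h.ge), ← h, div_self (by linarith), sub_self,
          Real.zero_rpow (by linarith), mul_zero]
      · rw [sphDensity, if_neg]
        rw [Real.le_sqrt (abs_nonneg s) (by positivity), sq_abs]
        exact h.not_ge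
    rw [h0]
    have := gaussDensity_pos s
    positivity

lemma le_sphDensity {n : ℕ} (hn : 4 ≤ n) {s : ℝ} (hs : s ^ 2 ≤ n / 4) :
    (1 - 2 / (n : ℝ)) * (rexp (-s ^ 4 / (2 * n)) * gaussDensity s) ≤ sphDensity n s := by
  have hn' : (4 : ℝ) ≤ n := by exact_mod_cast hn
  have hx : s ^ 2 / (n : ℝ) ≤ 1 / 4 := by
    rw [div_le_iff₀ (by linarith)]
    linarith
  rw [sphDensity_of_abs_le (Real.abs_le_sqrt (by linarith)), gaussDensity_eq,
    Real.rpow_def_of_pos (by linarith), mul_left_comm (rexp _), ← Real.exp_add, ← mul_assoc]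
  refine mul_le_mul (le_sphConst hn) (Real.exp_le_exp.2 ?_) (Real.exp_pos _).le (sphConst_pos hn).le
  have hlog := le_log_one_sub (x := s ^ 2 / n) (by positivity) hx
  have h3 := mul_le_mul_of_nonneg_right hlog (show 0 ≤ ((n : ℝ) - 3) / 2 by linarith)
  refine le_trans ?_ h3
  have key : (-(s ^ 2 / n) - (s ^ 2 / n) ^ 2) * (((n : ℝ) - 3) / 2) -
      (-s ^ 4 / (2 * n) + -(1 / 2) * s ^ 2) = 3 * s ^ 2 / (2 * n) + 3 * s ^ 4 / (2 * n ^ 2) := by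
    field_simp
    ring
  have : 0 ≤ 3 * s ^ 2 / (2 * n) + 3 * s ^ 4 / (2 * (n : ℝ) ^ 2) := by positivity
  linarith

lemma one_sub_sphCDF_le {n : ℕ} (hn : 4 ≤ n) {t : ℝ} (ht : 0 ≤ t) :
    1 - sphCDF n t ≤ rexp (18 / n) * (1 - gaussCDF t) * rexp (-t ^ 4 / (32 * n)) := by
  rw [one_sub_sphCDF hn, one_sub_gaussCDF, mul_right_comm, ← integral_const_mul]
  refine setIntegral_mono_on (integrable_sphDensity hn).integrableOn
    (integrable_gaussDensity.const_mul _).integrableOn measurableSet_Ioi fun s hs => ?_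
  refine (sphDensity_le hn).trans (mul_le_mul_of_nonneg_right ?_ (gaussDensity_pos s).le)
  have : t ≤ s := le_of_lt hs
  gcongr

/-- Minus the derivative of the comparison function `(1 - Φ(s)) e^{-s⁴/n}` is controlled
by the spherical density. -/
lemma neg_deriv_tail_le {n : ℕ} (hn : 4 ≤ n) {s : ℝ} (hs : s ^ 2 ≤ n / 4) :
    (1 - 2 / (n : ℝ)) * rexp (-8 / n) * (gaussDensity s * rexp (-s ^ 4 / n) +
      (1 - gaussCDF s) * (rexp (-s ^ 4 / n) * (4 * s ^ 3 / n))) ≤ sphDensity n s := by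
  have hn' : (4 : ℝ) ≤ n := by exact_mod_cast hn
  refine le_trans ?_ (le_sphDensity hn hs)
  have h2 : 0 ≤ 1 - 2 / (n : ℝ) := by
    rw [sub_nonneg, div_le_one (by linarith)]
    linarith
  rw [mul_assoc]
  refine mul_le_mul_of_nonneg_left ?_ h2
  have hm := mul_le_mul_of_nonneg_left (mul_one_sub_gaussCDF_le s)
    (show 0 ≤ 4 * s ^ 2 / (n : ℝ) by positivity)
  have hφ := gaussDensity_pos s
  calc rexp (-8 / n) * (gaussDensity s * rexp (-s ^ 4 / n) +
        (1 - gaussCDF s) * (rexp (-s ^ 4 / n) * (4 * s ^ 3 / n)))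
      = rexp (-8 / n) * rexp (-s ^ 4 / n) *
          (gaussDensity s + 4 * s ^ 2 / n * (s * (1 - gaussCDF s))) := by ring
    _ ≤ rexp (-8 / n) * rexp (-s ^ 4 / n) *
          (gaussDensity s + 4 * s ^ 2 / n * gaussDensity s) := by gcongr
    _ = rexp (-8 / n) * rexp (-s ^ 4 / n) * (4 * s ^ 2 / n + 1) * gaussDensity s := by ring
    _ ≤ rexp (-8 / n) * rexp (-s ^ 4 / n) * rexp (4 * s ^ 2 / n) * gaussDensity s := by
        gcongr
        exact Real.add_one_le_exp _
    _ ≤ rexp (-s ^ 4 / (2 * n)) * gaussDensity s := by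
        rw [← Real.exp_add, ← Real.exp_add]
        gcongr
        have key : -s ^ 4 / (2 * n) - (-8 / n + -s ^ 4 / n + 4 * s ^ 2 / n) =
            (s ^ 2 - 4) ^ 2 / (2 * (n : ℝ)) := by
          field_simp
          ring
        have : 0 ≤ (s ^ 2 - 4) ^ 2 / (2 * (n : ℝ)) := by positivity
        linarith

lemma le_one_sub_sphCDF {n : ℕ} (hn : 4 ≤ n) {t : ℝ} (ht : 0 < t) (htn : t < 1 / 4 * √n) :
    (1 - 2 / (n : ℝ)) * rexp (-8 / n) * (1 - rexp (-n / 32)) * (1 - gaussCDF t) *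
      rexp (-t ^ 4 / n) ≤ 1 - sphCDF n t := by
  have hn' : (4 : ℝ) ≤ n := by exact_mod_cast hn
  have hr : 0 < √(n : ℝ) := by positivity
  have hr2 : √(n : ℝ) ^ 2 = n := Real.sq_sqrt (by positivity)
  have h2 : 0 ≤ 1 - 2 / (n : ℝ) := by
    rw [sub_nonneg, div_le_one (by linarith)]
    linarith
  set q := (1 - 2 / (n : ℝ)) * rexp (-8 / n) with hq
  have hq0 : 0 ≤ q := mul_nonneg h2 (Real.exp_pos _).le
  set B := √(n : ℝ) / 2 with hB
  have htB : t ≤ B := by linarith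
  let H : ℝ → ℝ := fun s => (1 - gaussCDF s) * rexp (-s ^ 4 / n)
  have hH (s : ℝ) : HasDerivAt (fun s => -(q * H s)) (q * (gaussDensity s * rexp (-s ^ 4 / n) +
      (1 - gaussCDF s) * (rexp (-s ^ 4 / n) * (4 * s ^ 3 / n)))) s := by
    have h4 : HasDerivAt (fun s : ℝ => -s ^ 4 / n) (-(4 * s ^ 3 / n)) s := by
      convert! (hasDerivAt_pow 4 s).neg.div_const (n : ℝ) using 1
      push_cast
      ring
    convert! ((((hasDerivAt_gaussCDF s).const_sub 1).mul h4.exp).const_mul q).neg using 1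
    ring
  have hFTC := intervalIntegral.sub_le_integral_of_hasDeriv_right_of_le htB
    (HasDerivAt.continuousOn fun s _ => hH s) (fun s _ => (hH s).hasDerivWithinAt)
    (integrable_sphDensity hn).integrableOn fun s hs => neg_deriv_tail_le hn (by
      have h0 : 0 < s := ht.trans hs.1
      have h1 : s ^ 2 ≤ B ^ 2 := by
        have := hs.2.le
        gcongr
      rw [hB, div_pow, hr2] at h1
      linarith)
  have h_int : ∫ s in t..B, sphDensity n s ≤ 1 - sphCDF n t := by
    rw [one_sub_sphCDF hn, intervalIntegral.integral_of_le htB]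
    exact setIntegral_mono_set (integrable_sphDensity hn).integrableOn
      (ae_of_all _ (sphDensity_nonneg hn)) (ae_of_all _ fun s hs => hs.1)
  have hHB : H B ≤ rexp (-n / 32) * H t := by
    have h4 : t ^ 4 ≤ (1 / 4 * √(n : ℝ)) ^ 4 := by gcongr
    have h5 : (1 / 4 * √(n : ℝ)) ^ 4 = (n : ℝ) ^ 2 / 256 := by
      rw [mul_pow, show √(n : ℝ) ^ 4 = (√(n : ℝ) ^ 2) ^ 2 by ring, hr2]
      ring
    have h6 : B ^ 4 = (n : ℝ) ^ 2 / 16 := by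
      rw [hB, div_pow, show √(n : ℝ) ^ 4 = (√(n : ℝ) ^ 2) ^ 2 by ring, hr2]
      ring
    calc H B ≤ (1 - gaussCDF t) * rexp (-n / 32 + -t ^ 4 / n) := by
          refine mul_le_mul (sub_le_sub_left (gaussCDF_mono htB) 1) (Real.exp_le_exp.2 ?_)
            (Real.exp_pos _).le (one_sub_gaussCDF_nonneg t)
          have : -(n : ℝ) / 32 + -t ^ 4 / n = (-n ^ 2 / 32 - t ^ 4) / n := by
            field_simp
            ring
          rw [this, h6]
          gcongr
          nlinarith
      _ = rexp (-n / 32) * H t := by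
          rw [Real.exp_add]
          ring
  have := mul_le_mul_of_nonneg_left hHB hq0
  calc q * (1 - rexp (-n / 32)) * (1 - gaussCDF t) * rexp (-t ^ 4 / n)
      = q * H t - q * (rexp (-n / 32) * H t) := by ring
    _ ≤ 1 - sphCDF n t := by linarith

theorem stmt1 :
    ∃ (C C₁ C₂ : ℝ), 0 < C ∧ 0 < C₁ ∧ 0 < C₂ ∧
      ∃ ε : ℕ → ℝ, (∀ n, 0 ≤ ε n) ∧ Tendsto ε atTop (nhds 0) ∧
        ∀ n : ℕ, 4 ≤ n → ∀ t : ℝ, 0 < t → t < C * Real.sqrt n →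
          (1 - ε n) * (1 - gaussCDF t) * Real.exp (-t ^ 4 / (C₂ * (n : ℝ)))
              ≤ 1 - sphCDF n t ∧
          1 - sphCDF n t
              ≤ (1 + ε n) * (1 - gaussCDF t) * Real.exp (-t ^ 4 / (C₁ * (n : ℝ))) := by
  let q : ℕ → ℝ := fun n => (1 - 2 / (n : ℝ)) * rexp (-8 / n) * (1 - rexp (-n / 32))
  have hdiv (c : ℝ) : Tendsto (fun n : ℕ => c / (n : ℝ)) atTop (nhds 0) :=
    tendsto_const_div_atTop_nhds_zero_nat c
  have hexp (c : ℝ) : Tendsto (fun n : ℕ => rexp (c / n)) atTop (nhds 1) := by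
    simpa using (hdiv c).rexp
  have hexp' : Tendsto (fun n : ℕ => rexp (-n / 32)) atTop (nhds 0) := by
    refine Real.tendsto_exp_atBot.comp ?_
    refine (tendsto_neg_atTop_atBot.comp ((tendsto_natCast_atTop_atTop (R := ℝ)).atTop_div_const
      (show (0 : ℝ) < 32 by norm_num))).congr fun n => ?_
    simp only [Function.comp]
    ring
  have hq : Tendsto q atTop (nhds 1) := by
    simpa using (((hdiv 2).const_sub 1).mul (hexp (-8))).mul (hexp'.const_sub 1)
  refine ⟨1 / 4, 32, 1, by norm_num, by norm_num, one_pos,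
    fun n => |rexp (18 / n) - 1| + |1 - q n|, fun n => by positivity, ?_, ?_⟩
  · simpa using ((hexp 18).sub_const 1).abs.add (hq.const_sub 1).abs
  intro n hn t ht htn
  have hT := one_sub_gaussCDF_nonneg t
  constructor
  · refine le_trans ?_ (le_one_sub_sphCDF hn ht htn)
    rw [one_mul]
    have := le_abs_self (1 - q n)
    have := abs_nonneg (rexp (18 / n) - 1)
    gcongr
    change _ ≤ q n
    linarith
  · refine (one_sub_sphCDF_le hn ht.le).trans ?_
    have := le_abs_self (rexp (18 / n) - 1)
    have := abs_nonneg (1 - q n)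
    gcongr
    linarith
end

section
/- There exist constants c₁, C₂ > 0 such that for every n ≥ 7, every t > 0 and every u ∈ [0,1]: (i) if 2·t² < n then ψ_n((1+u)·t) ≤ exp(-c₁·u·t²)·ψ_n(t); (ii) if 2·(1+u)²·t² < n then ψ_n(t) ≤ exp(C₂·u·t²)·ψ_n((1+u)·t). -/
open MeasureTheory Real

lemma rpow_le_exp_mul_rpow {A B s a r : ℝ} (hA : 0 ≤ A) (hB : 0 ≤ B) (ha : 0 ≤ a)
    (h : A ≤ B * Real.exp s) (hr : s * a ≤ r) : A ^ a ≤ Real.exp r * B ^ a := by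
  calc A ^ a ≤ (B * Real.exp s) ^ a := Real.rpow_le_rpow hA h ha
    _ = Real.exp (s * a) * B ^ a := by
      rw [Real.mul_rpow hB (Real.exp_pos s).le, ← Real.exp_mul, mul_comm]
    _ ≤ Real.exp r * B ^ a :=
      mul_le_mul_of_nonneg_right (Real.exp_le_exp.2 hr) (Real.rpow_nonneg hB a)

lemma sphDensity_const_nonneg {n : ℕ} (hn : 1 ≤ n) :
    0 ≤ (Real.sqrt (Real.pi * n))⁻¹ *
      (Real.Gamma ((n : ℝ) / 2) / Real.Gamma (((n : ℝ) - 1) / 2)) := by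
  have hn' : (1 : ℝ) ≤ n := by exact_mod_cast hn
  have h₁ : 0 ≤ Real.Gamma ((n : ℝ) / 2) := Real.Gamma_nonneg_of_nonneg (by linarith)
  have h₂ : 0 ≤ Real.Gamma (((n : ℝ) - 1) / 2) := Real.Gamma_nonneg_of_nonneg (by linarith)
  positivity

lemma abs_le_sqrt_natCast_iff {n : ℕ} (hn : 0 < n) (t : ℝ) :
    |t| ≤ Real.sqrt n ↔ 0 ≤ 1 - t ^ 2 / (n : ℝ) := by
  have hn' : (0 : ℝ) < n := by exact_mod_cast hn
  rw [Real.le_sqrt (abs_nonneg t) hn'.le, sq_abs, sub_nonneg, div_le_one hn']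

lemma sphDensity_le_exp_mul {n : ℕ} (hn : 3 ≤ n) {t v s r : ℝ} (hv : 0 ≤ 1 - v ^ 2 / (n : ℝ))
    (h : 1 - t ^ 2 / (n : ℝ) ≤ (1 - v ^ 2 / (n : ℝ)) * Real.exp s)
    (hr : s * (((n : ℝ) - 3) / 2) ≤ r) :
    sphDensity n t ≤ Real.exp r * sphDensity n v := by
  have hn' : (3 : ℝ) ≤ n := by exact_mod_cast hn
  have hC := sphDensity_const_nonneg (n := n) (by lia)
  unfold sphDensity
  simp only [abs_le_sqrt_natCast_iff (n := n) (by lia), if_pos hv]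
  split_ifs with ht
  · rw [mul_left_comm]
    exact mul_le_mul_of_nonneg_left
      (rpow_le_exp_mul_rpow ht hv (by linarith) h hr) hC
  · exact mul_nonneg (Real.exp_pos r).le (mul_nonneg hC (Real.rpow_nonneg hv _))

theorem stmt3 :
    ∃ (c₁ C₂ : ℝ), 0 < c₁ ∧ 0 < C₂ ∧
      ∀ n : ℕ, 7 ≤ n → ∀ t : ℝ, 0 < t → ∀ u ∈ Set.Icc (0 : ℝ) 1,
        (2 * t ^ 2 < (n : ℝ) →
          sphDensity n ((1 + u) * t) ≤ Real.exp (-c₁ * u * t ^ 2) * sphDensity n t) ∧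
        (2 * (1 + u) ^ 2 * t ^ 2 < (n : ℝ) →
          sphDensity n t ≤ Real.exp (C₂ * u * t ^ 2) * sphDensity n ((1 + u) * t)) := by
  refine ⟨1 / 2, 3, by norm_num, by norm_num, ?_⟩
  rintro n hn t - u ⟨hu0, hu1⟩
  have hn' : (7 : ℝ) ≤ n := by exact_mod_cast hn
  have hnpos : (0 : ℝ) < n := by linarith
  obtain ⟨x, hx⟩ : ∃ x, x = t ^ 2 / (n : ℝ) := ⟨_, rfl⟩
  have hx0 : 0 ≤ x := by rw [hx]; positivity
  have ht : t ^ 2 = x * n := by rw [hx]; field_simp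
  have hy : ((1 + u) * t) ^ 2 / (n : ℝ) = x + (2 * u + u ^ 2) * x := by rw [hx]; ring
  have hd : 0 ≤ (2 * u + u ^ 2) * x := by positivity
  have hux : 0 ≤ u * x := by positivity
  constructor
  · intro h
    have hx1 : x ≤ 1 / 2 := by rw [hx, div_le_iff₀ hnpos]; linarith
    refine sphDensity_le_exp_mul (s := -((2 * u + u ^ 2) * x)) (by lia) ?_ ?_ ?_
    · rw [← hx]; linarith
    · rw [hy, ← hx]
      nlinarith [Real.add_one_le_exp (-((2 * u + u ^ 2) * x)), mul_nonneg hx0 hd]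
    · rw [ht]
      nlinarith [mul_nonneg hux (by linarith : (0 : ℝ) ≤ n - 7),
        mul_nonneg (mul_nonneg hux hu0) (by linarith : (0 : ℝ) ≤ n - 7)]
  · intro h
    have hy1 : x + (2 * u + u ^ 2) * x ≤ 1 / 2 := by
      rw [← hy, div_le_iff₀ hnpos]; nlinarith
    refine sphDensity_le_exp_mul (s := 2 * ((2 * u + u ^ 2) * x)) (by lia) ?_ ?_ ?_
    · rw [hy]; linarith
    · rw [hy, ← hx]
      nlinarith [Real.add_one_le_exp (2 * ((2 * u + u ^ 2) * x))]
    · rw [ht]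
      nlinarith [mul_nonneg (mul_nonneg hux (by linarith : (0 : ℝ) ≤ 1 - u)) hnpos.le,
        mul_nonneg hux hu0]
end

section
/- For every n ≥ 2, every Borel set A ⊆ S^{n-1} and every γ > 0, one has σ(A)·(1 - σ({A}_γ)) ≤ exp(-(n-1)·γ²/4). -/
open MeasureTheory Real

/-- `σ` is the rotation-invariant probability measure on the unit sphere `S^{n-1}`,
viewed as a measure on the ambient space supported on the sphere. -/
structure IsUniformSphereMeasure {n : ℕ} (σ : Measure (EuclideanSpace ℝ (Fin n))) : Prop where
  prob : IsProbabilityMeasure σ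
  sphere : σ (Metric.sphere (0 : EuclideanSpace ℝ (Fin n)) 1) = 1
  rotInv : ∀ O : EuclideanSpace ℝ (Fin n) ≃ₗᵢ[ℝ] EuclideanSpace ℝ (Fin n),
    Measure.map O σ = σ

/-- The `γ`-extension of a subset `A` of the unit sphere `S^{n-1}`. -/
def sphExt {n : ℕ} (A : Set (EuclideanSpace ℝ (Fin n))) (γ : ℝ) :
    Set (EuclideanSpace ℝ (Fin n)) :=
  {ξ | ‖ξ‖ = 1 ∧ ∃ η ∈ A, ‖ξ - η‖ ≤ γ}

/-- One-dimensional Brunn–Minkowski inequality. -/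
theorem volume_add_volume_le_of_add_mem {A B C : Set ℝ} (hA : MeasurableSet A)
    (hB : MeasurableSet B) (hA₀ : A.Nonempty) (hB₀ : B.Nonempty)
    (h : ∀ a ∈ A, ∀ b ∈ B, a + b ∈ C) : volume A + volume B ≤ volume C := by
  have compact_case : ∀ K ⊆ A, IsCompact K → K.Nonempty → ∀ L ⊆ B, IsCompact L → L.Nonempty →
      volume K + volume L ≤ volume C := by
    intro K hKA hK hK₀ L hLB hL hL₀
    obtain ⟨l, hl, hl_min⟩ := hL.exists_isLeast hL₀
    obtain ⟨k, hk, hk_max⟩ := hK.exists_isGreatest hK₀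
    have hdisj : AEDisjoint volume ((fun x => l + x) '' K) ((fun x => k + x) '' L) := by
      refine measure_mono_null (t := {k + l}) ?_ (by simp)
      rintro _ ⟨⟨x, hx, rfl⟩, ⟨y, hy, hxy⟩⟩
      have h₁ := hk_max hx
      have h₂ := hl_min hy
      simp only [Set.mem_singleton_iff] at hxy ⊢
      linarith
    have hLm : MeasurableSet ((fun x => k + x) '' L) :=
      (hL.image (by fun_prop)).measurableSet
    calc volume K + volume L
        = volume ((fun x => l + x) '' K) + volume ((fun x => k + x) '' L) := by
          simp only [Set.image_add_left, measure_preimage_add]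
      _ = volume ((fun x => l + x) '' K ∪ (fun x => k + x) '' L) :=
          (measure_union₀ hLm.nullMeasurableSet hdisj).symm
      _ ≤ volume C := by
          refine measure_mono (Set.union_subset ?_ ?_)
          · rintro _ ⟨x, hx, rfl⟩
            simpa [add_comm] using h x (hKA hx) l (hLB hl)
          · rintro _ ⟨y, hy, rfl⟩
            exact h k (hKA hk) y (hLB hy)
  obtain ⟨a, ha⟩ := hA₀
  obtain ⟨b, hb⟩ := hB₀
  rw [hA.measure_eq_iSup_isCompact, hB.measure_eq_iSup_isCompact]
  simp only [iSup_and']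
  refine ENNReal.biSup_add_biSup_le' ⟨∅, by simp⟩ ⟨∅, by simp⟩ ?_
  rintro K ⟨hKA, hK⟩ L ⟨hLB, hL⟩
  calc volume K + volume L ≤ volume (insert a K) + volume (insert b L) := by
        gcongr <;> exact Set.subset_insert _ _
    _ ≤ volume C := compact_case _ (Set.insert_subset ha hKA) (hK.insert a)
        (Set.insert_nonempty _ _) _ (Set.insert_subset hb hLB) (hL.insert b)
        (Set.insert_nonempty _ _)

/-- A Prékopa–Leindler inequality in additive form, for real functions with supremum `1`. -/
theorem lintegral_add_lintegral_le_of_mul_le_sq {F G H : ℝ → ℝ} (hF : Measurable F)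
    (hG : Measurable G) (hH : Measurable H) (hF₀ : 0 ≤ F) (hG₀ : 0 ≤ G) (hH₀ : 0 ≤ H)
    (hF₁ : ∀ x, F x ≤ 1) (hG₁ : ∀ x, G x ≤ 1) (hFs : ∀ t, 0 < t → t < 1 → ∃ x, t < F x)
    (hGs : ∀ t, 0 < t → t < 1 → ∃ x, t < G x) (h : ∀ x y, F x * G y ≤ H (x + y) ^ 2) :
    (∫⁻ x, ENNReal.ofReal (F x)) + ∫⁻ x, ENNReal.ofReal (G x) ≤ ∫⁻ x, ENNReal.ofReal (H x) := by
  rw [lintegral_eq_lintegral_meas_lt volume (ae_of_all _ hF₀) hF.aemeasurable,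
    lintegral_eq_lintegral_meas_lt volume (ae_of_all _ hG₀) hG.aemeasurable,
    lintegral_eq_lintegral_meas_lt volume (ae_of_all _ hH₀) hH.aemeasurable]
  have hanti : Antitone fun t => volume {x | t < F x} := fun s t hst =>
    measure_mono fun x (hx : t < F x) => hst.trans_lt hx
  rw [← lintegral_add_left hanti.measurable]
  refine setLIntegral_mono' measurableSet_Ioi fun t ht => ?_
  rcases lt_or_ge t 1 with ht₁ | ht₁
  · refine volume_add_volume_le_of_add_mem (measurableSet_lt measurable_const hF)
      (measurableSet_lt measurable_const hG) (hFs t ht ht₁) (hGs t ht ht₁) ?_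
    intro x (hx : t < F x) y (hy : t < G y)
    have ht₀ : 0 < t := ht
    have := h x y
    have := hH₀ (x + y)
    simp only [Pi.zero_apply] at this
    show t < H (x + y)
    refine lt_of_pow_lt_pow_left₀ 2 this ?_
    nlinarith
  · have hFe : {x | t < F x} = ∅ := by
      ext x; simpa using (hF₁ x).trans ht₁
    have hGe : {x | t < G x} = ∅ := by
      ext x; simpa using (hG₁ x).trans ht₁
    simp [hFe, hGe]

theorem ENNReal.four_mul_mul_le_add_sq (u v : ENNReal) : 4 * (u * v) ≤ (u + v) ^ 2 := by
  wlog h : u ≤ v generalizing u v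
  · rw [mul_comm u, add_comm u]
    exact this v u (le_of_not_ge h)
  obtain ⟨d, rfl⟩ := exists_add_of_le h
  calc 4 * (u * (u + d)) ≤ 4 * (u * (u + d)) + d ^ 2 := le_self_add
    _ = (u + (u + d)) ^ 2 := by ring

/-- `μ` satisfies the midpoint Prékopa–Leindler inequality with constant `c`. -/
def PrekopaLeindler {E : Type*} [MeasurableSpace E] [Add E] (μ : Measure E) (c : ENNReal) : Prop :=
  ∀ f g h : E → ENNReal, Measurable f → Measurable g → Measurable h →
    (∀ x y, f x * g y ≤ h (x + y) ^ 2) →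
      c * ((∫⁻ x, f x ∂μ) * ∫⁻ x, g x ∂μ) ≤ (∫⁻ x, h x ∂μ) ^ 2

theorem four_mul_lintegral_mul_le_of_iSup_ne_top {f g h : ℝ → ENNReal} (hf : Measurable f)
    (hg : Measurable g) (hh : Measurable h) (hfg : ∀ x y, f x * g y ≤ h (x + y) ^ 2)
    (hf_top : ⨆ x, f x ≠ ⊤) (hg_top : ⨆ x, g x ≠ ⊤) :
    4 * ((∫⁻ x, f x) * ∫⁻ x, g x) ≤ (∫⁻ x, h x) ^ 2 := by
  set a := ⨆ x, f x with ha
  set b := ⨆ x, g x with hb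
  have hfa : ∀ x, f x ≤ a := le_iSup f
  have hgb : ∀ x, g x ≤ b := le_iSup g
  rcases eq_or_ne a 0 with ha₀ | ha₀
  · have : ∀ x, f x = 0 := fun x => le_antisymm ((hfa x).trans ha₀.le) zero_le
    simp [this]
  rcases eq_or_ne b 0 with hb₀ | hb₀
  · have : ∀ x, g x = 0 := fun x => le_antisymm ((hgb x).trans hb₀.le) zero_le
    simp [this]
  obtain ⟨s, hs⟩ : ∃ s : ENNReal, s ^ 2 = a * b :=
    ⟨(a * b) ^ (1 / 2 : ℝ), by rw [← ENNReal.rpow_natCast, ← ENNReal.rpow_mul]; norm_num⟩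
  have hab₀ : a * b ≠ 0 := mul_ne_zero ha₀ hb₀
  have hab_top : a * b ≠ ⊤ := ENNReal.mul_ne_top hf_top hg_top
  have hs₀ : s ≠ 0 := by rintro rfl; simp [eq_comm, ha₀, hb₀] at hs
  have hs_top : s ≠ ⊤ := by rintro rfl; simp [eq_comm, hab_top] at hs
  have hfa₁ : ∀ x, f x / a ≤ 1 := fun x => ENNReal.div_le_of_le_mul (by simpa using hfa x)
  have hgb₁ : ∀ x, g x / b ≤ 1 := fun x => ENNReal.div_le_of_le_mul (by simpa using hgb x)
  have hmin : ∀ x, min (h x / s) 1 ≠ ⊤ := fun x => ne_top_of_le_ne_top ENNReal.one_ne_top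
    (min_le_right _ _)
  have key : ∀ x y, f x / a * (g y / b) ≤ min (h (x + y) / s) 1 ^ 2 := by
    intro x y
    rcases le_total (h (x + y) / s) 1 with h₁ | h₁
    · rw [min_eq_left h₁, ← ENNReal.mul_div_mul_comm (Or.inl ha₀) (Or.inl hf_top), ← hs,
        pow_two (_ / _), ← ENNReal.mul_div_mul_comm (Or.inl hs₀) (Or.inl hs_top), ← pow_two,
        ← pow_two]
      gcongr
      exact hfg x y
    · rw [min_eq_right h₁, one_pow]
      exact mul_le_one' (hfa₁ x) (hgb₁ y)
  have hfa_top : ∀ x, f x / a ≠ ⊤ := fun x => ne_top_of_le_ne_top ENNReal.one_ne_top (hfa₁ x)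
  have hgb_top : ∀ x, g x / b ≠ ⊤ := fun x => ne_top_of_le_ne_top ENNReal.one_ne_top (hgb₁ x)
  have exists_lt : ∀ (u : ℝ → ENNReal) (m : ENNReal), m = ⨆ x, u x → m ≠ 0 → m ≠ ⊤ →
      (∀ x, u x / m ≠ ⊤) → ∀ t : ℝ, 0 < t → t < 1 → ∃ x, t < (u x / m).toReal := by
    intro u m hm hm₀ hm_top hu t ht ht₁
    have : ENNReal.ofReal t * m < ⨆ x, u x := by
      rw [← hm]
      conv_rhs => rw [← one_mul m]
      exact (ENNReal.mul_lt_mul_iff_left hm₀ hm_top).2 (by simpa using ht₁)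
    obtain ⟨x, hx⟩ := lt_iSup_iff.1 this
    refine ⟨x, (ENNReal.ofReal_lt_iff_lt_toReal ht.le (hu x)).1 ?_⟩
    exact (ENNReal.lt_div_iff_mul_lt (Or.inl hm₀) (Or.inl hm_top)).2 hx
  have main := lintegral_add_lintegral_le_of_mul_le_sq
    (F := fun x => (f x / a).toReal) (G := fun x => (g x / b).toReal)
    (H := fun x => (min (h x / s) 1).toReal) (by fun_prop) (by fun_prop)
    ((hh.div_const s).min measurable_const).ennreal_toReal
    (fun _ => ENNReal.toReal_nonneg) (fun _ => ENNReal.toReal_nonneg)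
    (fun _ => ENNReal.toReal_nonneg)
    (fun x => ENNReal.toReal_le_of_le_ofReal zero_le_one (by simpa using hfa₁ x))
    (fun x => ENNReal.toReal_le_of_le_ofReal zero_le_one (by simpa using hgb₁ x))
    (exists_lt f a ha ha₀ hf_top hfa_top) (exists_lt g b hb hb₀ hg_top hgb_top)
    (fun x y => by
      rw [← ENNReal.toReal_mul, ← ENNReal.toReal_pow]
      exact ENNReal.toReal_mono (ENNReal.pow_ne_top (hmin _)) (key x y))
  simp only [ENNReal.ofReal_toReal (hfa_top _), ENNReal.ofReal_toReal (hgb_top _),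
    ENNReal.ofReal_toReal (hmin _)] at main
  have main' : (∫⁻ x, f x) / a + (∫⁻ x, g x) / b ≤ (∫⁻ x, h x) / s := by
    simp only [div_eq_mul_inv] at main ⊢
    rw [← lintegral_mul_const _ hf, ← lintegral_mul_const _ hg, ← lintegral_mul_const _ hh]
    exact main.trans (lintegral_mono fun x => min_le_left _ _)
  have hdiv : 4 * ((∫⁻ x, f x) * ∫⁻ x, g x) / (a * b) ≤ (∫⁻ x, h x) ^ 2 / (a * b) := by
    calc 4 * ((∫⁻ x, f x) * ∫⁻ x, g x) / (a * b)
        = 4 * ((∫⁻ x, f x) / a * ((∫⁻ x, g x) / b)) := by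
          rw [mul_div_assoc, ENNReal.mul_div_mul_comm (Or.inl ha₀) (Or.inl hf_top)]
      _ ≤ ((∫⁻ x, f x) / a + (∫⁻ x, g x) / b) ^ 2 := ENNReal.four_mul_mul_le_add_sq _ _
      _ ≤ ((∫⁻ x, h x) / s) ^ 2 := by gcongr
      _ = (∫⁻ x, h x) ^ 2 / (a * b) := by
          rw [← hs, pow_two, ← ENNReal.mul_div_mul_comm (Or.inl hs₀) (Or.inl hs_top), ← pow_two,
            ← pow_two]
  rwa [ENNReal.div_le_iff hab₀ hab_top, ENNReal.div_mul_cancel hab₀ hab_top] at hdiv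

theorem prekopaLeindler_real : PrekopaLeindler (volume : Measure ℝ) 4 := by
  intro f g h hf hg hh hfg
  have trunc : ∀ u : ℝ → ENNReal, Measurable u →
      ∫⁻ x, u x = ⨆ k : ℕ, ∫⁻ x, min (u x) k := by
    intro u hu
    rw [← lintegral_iSup (fun k => hu.min measurable_const)
      (fun i j hij x => min_le_min le_rfl (by exact_mod_cast hij))]
    congr with x
    rw [← inf_iSup_eq, ENNReal.iSup_natCast, inf_top_eq]
  rw [trunc f hf, trunc g hg, ENNReal.iSup_mul, ENNReal.mul_iSup]
  refine iSup_le fun k => ?_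
  rw [ENNReal.mul_iSup, ENNReal.mul_iSup]
  refine iSup_le fun l => ?_
  have bdd : ∀ (u : ℝ → ENNReal) (k : ℕ), ⨆ x, min (u x) k ≠ ⊤ := fun u k =>
    ne_top_of_le_ne_top (ENNReal.natCast_ne_top k) (iSup_le fun x => min_le_right _ _)
  exact four_mul_lintegral_mul_le_of_iSup_ne_top (hf.min measurable_const)
    (hg.min measurable_const) hh
    (fun x y => (mul_le_mul' (min_le_left _ _) (min_le_left _ _)).trans (hfg x y))
    (bdd f k) (bdd g l)

namespace PrekopaLeindler

theorem prod {E F : Type*} [MeasurableSpace E] [Add E] [MeasurableSpace F] [Add F]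
    {μ : Measure E} {ν : Measure F} [SFinite μ] [SFinite ν] {c d : ENNReal}
    (hμ : PrekopaLeindler μ c) (hν : PrekopaLeindler ν d) :
    PrekopaLeindler (μ.prod ν) (c * d) := by
  intro f g h hf hg hh hfg
  rw [lintegral_prod _ hf.aemeasurable, lintegral_prod _ hg.aemeasurable,
    lintegral_prod _ hh.aemeasurable]
  have hdf : Measurable fun x => ∫⁻ y, f (x, y) ∂ν := hf.lintegral_prod_right'
  have := hμ (fun x => d * ∫⁻ y, f (x, y) ∂ν) (fun x => ∫⁻ y, g (x, y) ∂ν)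
    (fun x => ∫⁻ y, h (x, y) ∂ν) (hdf.const_mul d) hg.lintegral_prod_right'
    hh.lintegral_prod_right' fun x x' => by
      rw [mul_assoc]
      exact hν (fun y => f (x, y)) (fun y => g (x', y)) (fun y => h (x + x', y))
        (by fun_prop) (by fun_prop) (by fun_prop) fun y y' => hfg (x, y) (x', y')
  rw [lintegral_const_mul _ hdf] at this
  simpa only [mul_assoc] using this

theorem of_measurePreserving {E F : Type*} [MeasurableSpace E] [Add E] [MeasurableSpace F]
    [Add F] {μ : Measure E} {ν : Measure F} {c : ENNReal} (hμ : PrekopaLeindler μ c)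
    (e : E ≃ᵐ F) (he : MeasurePreserving e μ ν) (hadd : ∀ x y, e (x + y) = e x + e y) :
    PrekopaLeindler ν c := by
  intro f g h hf hg hh hfg
  rw [← he.lintegral_comp hf, ← he.lintegral_comp hg, ← he.lintegral_comp hh]
  exact hμ _ _ _ (hf.comp e.measurable) (hg.comp e.measurable) (hh.comp e.measurable)
    fun x y => by simpa only [Function.comp_apply, hadd] using hfg (e x) (e y)

theorem volume_pi (n : ℕ) : PrekopaLeindler (volume : Measure (Fin n → ℝ)) (4 ^ n) := by
  induction n with
  | zero =>
    intro f g h _ _ _ hfg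
    have : (volume : Measure (Fin 0 → ℝ)) Set.univ = 1 := by simp [MeasureTheory.volume_pi]
    simp only [lintegral_unique, this, mul_one, pow_zero, one_mul]
    convert hfg default default
  | succ n ih =>
    rw [pow_succ']
    exact (prekopaLeindler_real.prod ih).of_measurePreserving
      (MeasurableEquiv.piFinSuccAbove (fun _ => ℝ) 0).symm
      (volume_preserving_piFinSuccAbove (fun _ : Fin (n + 1) => ℝ) 0).symm fun x y => by
        ext i
        refine Fin.cases ?_ (fun j => ?_) i <;> simp [MeasurableEquiv.piFinSuccAbove]

theorem volume_euclideanSpace (n : ℕ) :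
    PrekopaLeindler (volume : Measure (EuclideanSpace ℝ (Fin n))) (4 ^ n) :=
  (PrekopaLeindler.volume_pi n).of_measurePreserving (MeasurableEquiv.toLp 2 (Fin n → ℝ))
    (PiLp.volume_preserving_toLp (Fin n)) fun _ _ => rfl

end PrekopaLeindler

namespace IsUniformSphereMeasure

variable {n : ℕ} {σ ν : Measure (EuclideanSpace ℝ (Fin n))}

theorem ae_norm_eq_one (hσ : IsUniformSphereMeasure σ) : ∀ᵐ x ∂σ, ‖x‖ = 1 := by
  have := hσ.prob
  simpa [ae_iff, Set.compl_def] using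
    (prob_compl_eq_zero_iff Metric.isClosed_sphere.measurableSet).2 hσ.sphere

theorem charFun_eq_of_norm_eq (hσ : IsUniformSphereMeasure σ) {x y : EuclideanSpace ℝ (Fin n)}
    (hxy : ‖x‖ = ‖y‖) : charFun σ x = charFun σ y := by
  set O := (ℝ ∙ (x - y))ᗮ.reflection
  have hOx : O x = y := Submodule.reflection_sub hxy
  rw [← hOx]
  conv_rhs => rw [← hσ.rotInv O]
  rw [charFun_apply, charFun_apply, integral_map O.continuous.aemeasurable
    (Continuous.aestronglyMeasurable (by fun_prop))]
  simp only [LinearIsometryEquiv.inner_map_map]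

/-- The rotation-invariant probability measure on the sphere is unique. -/
theorem unique (hσ : IsUniformSphereMeasure σ) (hν : IsUniformSphereMeasure ν) : σ = ν := by
  have := hσ.prob
  have := hν.prob
  refine Measure.ext_of_charFun (funext fun t => ?_)
  have average : ∀ {μ τ : Measure (EuclideanSpace ℝ (Fin n))}, IsUniformSphereMeasure μ →
      IsUniformSphereMeasure τ → ∫ x, charFun μ (‖t‖ • x) ∂τ = charFun μ t := by
    intro μ τ hμ hτ
    have := hτ.prob
    calc ∫ x, charFun μ (‖t‖ • x) ∂τ = ∫ _, charFun μ t ∂τ := by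
          refine integral_congr_ae ?_
          filter_upwards [hτ.ae_norm_eq_one] with x hx
          exact hμ.charFun_eq_of_norm_eq (by rw [norm_smul, hx]; simp)
      _ = charFun μ t := by simp
  rw [← average hσ hν, ← average hν hσ]
  simp only [charFun_apply]
  rw [integral_integral_swap]
  · simp only [inner_smul_right, real_inner_comm]
  · refine Integrable.of_bound (C := 1) (Continuous.aestronglyMeasurable ?_) ?_
    · unfold Function.uncurry
      fun_prop
    · refine ae_of_all _ fun p => ?_
      simp [Function.uncurry, Complex.norm_exp_ofReal_mul_I]

end IsUniformSphereMeasure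

/-- The image of the uniform distribution on the unit ball under radial projection. -/
noncomputable def coneMeasure (n : ℕ) : Measure (EuclideanSpace ℝ (Fin n)) :=
  (ProbabilityTheory.cond volume (Metric.ball 0 1)).map fun x => ‖x‖⁻¹ • x

section coneMeasure

variable {n : ℕ}

theorem coneMeasure_apply {S : Set (EuclideanSpace ℝ (Fin n))} (hS : MeasurableSet S) :
    coneMeasure n S = (volume (Metric.ball (0 : EuclideanSpace ℝ (Fin n)) 1))⁻¹ *
      volume (Metric.ball 0 1 ∩ (fun x : EuclideanSpace ℝ (Fin n) => ‖x‖⁻¹ • x) ⁻¹' S) := by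
  rw [coneMeasure, Measure.map_apply (by fun_prop) hS,
    ProbabilityTheory.cond_apply Metric.isOpen_ball.measurableSet]

theorem isUniformSphereMeasure_coneMeasure (hn : n ≠ 0) :
    IsUniformSphereMeasure (coneMeasure n) := by
  have : Nonempty (Fin n) := ⟨⟨0, Nat.pos_of_ne_zero hn⟩⟩
  have hball₀ : volume (Metric.ball (0 : EuclideanSpace ℝ (Fin n)) 1) ≠ 0 :=
    (Metric.measure_ball_pos _ _ one_pos).ne'
  have hball_top : volume (Metric.ball (0 : EuclideanSpace ℝ (Fin n)) 1) ≠ ⊤ :=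
    measure_ball_lt_top.ne
  have hcond : IsProbabilityMeasure
      (ProbabilityTheory.cond volume (Metric.ball (0 : EuclideanSpace ℝ (Fin n)) 1)) :=
    ProbabilityTheory.cond_isProbabilityMeasure_of_finite hball₀ hball_top
  have hproj : Measurable fun x : EuclideanSpace ℝ (Fin n) => ‖x‖⁻¹ • x := by fun_prop
  refine ⟨Measure.isProbabilityMeasure_map hproj.aemeasurable, ?_, fun O => ?_⟩
  · have hae : ∀ᵐ x ∂(volume : Measure (EuclideanSpace ℝ (Fin n))), x ≠ 0 :=
      Measure.ae_ne volume 0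
    have hdiff : volume (Metric.ball (0 : EuclideanSpace ℝ (Fin n)) 1 ∩
        (fun x : EuclideanSpace ℝ (Fin n) => ‖x‖⁻¹ • x) ⁻¹' Metric.sphere 0 1) =
        volume (Metric.ball (0 : EuclideanSpace ℝ (Fin n)) 1) := by
      refine measure_congr ?_
      filter_upwards [hae] with x hx
      refine propext ⟨And.left, fun h => ⟨h, ?_⟩⟩
      simp [norm_smul, hx]
    rw [coneMeasure_apply Metric.isClosed_sphere.measurableSet, hdiff,
      ENNReal.inv_mul_cancel hball₀ hball_top]
  · ext S hS
    have hO : MeasurableSet (O ⁻¹' S) := O.continuous.measurable hS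
    have hpre : MeasurableSet (Metric.ball (0 : EuclideanSpace ℝ (Fin n)) 1 ∩
        (fun x : EuclideanSpace ℝ (Fin n) => ‖x‖⁻¹ • x) ⁻¹' S) :=
      Metric.isOpen_ball.measurableSet.inter (hproj hS)
    rw [Measure.map_apply O.continuous.measurable hS, coneMeasure_apply hS, coneMeasure_apply hO,
      ← O.measurePreserving.measure_preimage hpre.nullMeasurableSet]
    congr 2
    ext x
    simp

end coneMeasure

theorem norm_add_sq_le_of_le_norm_sub {E : Type*} [NormedAddCommGroup E] [InnerProductSpace ℝ E]
    {a b : E} {s t γ R : ℝ} (ha : ‖a‖ = 1) (hb : ‖b‖ = 1) (hγ₀ : 0 ≤ γ) (hγ : γ ≤ ‖a - b‖)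
    (hs₀ : 0 ≤ s) (ht₀ : 0 ≤ t) (hs₁ : s ≤ 1) (ht₁ : t ≤ 1) (hR₁ : 1 ≤ R)
    (hR : 4 - γ ^ 2 ≤ R) : ‖s • a + t • b‖ ^ 2 ≤ R := by
  have hinner : 2 * inner ℝ a b ≤ R - 2 := by
    have h₁ := norm_sub_sq_real a b
    rw [ha, hb] at h₁
    have h₂ : γ ^ 2 ≤ ‖a - b‖ ^ 2 := by gcongr
    linarith
  have hexpand : ‖s • a + t • b‖ ^ 2 = s ^ 2 + t ^ 2 + s * t * (2 * inner ℝ a b) := by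
    rw [norm_add_sq_real, norm_smul, norm_smul, inner_smul_left, inner_smul_right, ha, hb]
    simp only [mul_one, Real.norm_eq_abs, sq_abs, conj_trivial]
    ring
  have hst : 0 ≤ s * t := mul_nonneg hs₀ ht₀
  have hquad : s ^ 2 + t ^ 2 - s * t ≤ 1 := by
    rcases le_total s t with h | h
    · nlinarith
    · nlinarith
  calc ‖s • a + t • b‖ ^ 2 ≤ s ^ 2 + t ^ 2 + s * t * (R - 2) := by rw [hexpand]; gcongr
    _ = (s - t) ^ 2 * 1 + s * t * R := by ring
    _ ≤ (s - t) ^ 2 * R + s * t * R := by gcongr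
    _ = (s ^ 2 + t ^ 2 - s * t) * R := by ring
    _ ≤ 1 * R := by gcongr
    _ = R := one_mul R

theorem four_pow_mul_coneMeasure_mul_le {n : ℕ} (hn : n ≠ 0)
    {A B : Set (EuclideanSpace ℝ (Fin n))} (hA : MeasurableSet A) (hB : MeasurableSet B)
    (hAs : A ⊆ Metric.sphere 0 1) (hBs : B ⊆ Metric.sphere 0 1) {γ R : ℝ} (hγ : 0 ≤ γ)
    (hAB : ∀ a ∈ A, ∀ b ∈ B, γ ≤ ‖a - b‖) (hR₁ : 1 ≤ R) (hR : 4 - γ ^ 2 ≤ R) :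
    4 ^ n * (coneMeasure n A * coneMeasure n B) ≤ ENNReal.ofReal (R ^ n) := by
  have : Nonempty (Fin n) := ⟨⟨0, Nat.pos_of_ne_zero hn⟩⟩
  set V := volume (Metric.ball (0 : EuclideanSpace ℝ (Fin n)) 1) with hV
  have hV₀ : V ≠ 0 := (Metric.measure_ball_pos _ _ one_pos).ne'
  have hV_top : V ≠ ⊤ := measure_ball_lt_top.ne
  have hproj : Measurable fun x : EuclideanSpace ℝ (Fin n) => ‖x‖⁻¹ • x := by fun_prop
  set cone : Set (EuclideanSpace ℝ (Fin n)) → Set (EuclideanSpace ℝ (Fin n)) := fun S =>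
    Metric.ball 0 1 ∩ (fun x : EuclideanSpace ℝ (Fin n) => ‖x‖⁻¹ • x) ⁻¹' S
  have cone_meas : ∀ {S}, MeasurableSet S → MeasurableSet (cone S) := fun hS =>
    Metric.isOpen_ball.measurableSet.inter (hproj hS)
  have polar : ∀ x : EuclideanSpace ℝ (Fin n), x = ‖x‖ • (‖x‖⁻¹ • x) := by
    intro x
    rcases eq_or_ne x 0 with rfl | hx₀
    · simp
    · rw [smul_inv_smul₀ (norm_ne_zero_iff.2 hx₀)]
  have hadd : ∀ x ∈ cone A, ∀ y ∈ cone B, x + y ∈ Metric.closedBall 0 √R := by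
    intro x hx y hy
    rw [mem_closedBall_zero_iff]
    refine Real.le_sqrt_of_sq_le ?_
    rw [polar x, polar y]
    exact norm_add_sq_le_of_le_norm_sub (by simpa using hAs hx.2) (by simpa using hBs hy.2) hγ
      (hAB _ hx.2 _ hy.2) (norm_nonneg x) (norm_nonneg y)
      (mem_ball_zero_iff.1 hx.1).le (mem_ball_zero_iff.1 hy.1).le hR₁ hR
  have hPL := PrekopaLeindler.volume_euclideanSpace n ((cone A).indicator 1)
    ((cone B).indicator 1) ((Metric.closedBall 0 √R).indicator 1)
    (measurable_one.indicator (cone_meas hA)) (measurable_one.indicator (cone_meas hB))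
    (measurable_one.indicator Metric.isClosed_closedBall.measurableSet) (by
      intro x y
      by_cases hx : x ∈ cone A
      · by_cases hy : y ∈ cone B
        · simp [hx, hy, Set.indicator_of_mem (hadd x hx y hy)]
        · simp [hy]
      · simp [hx])
  rw [lintegral_indicator_one (cone_meas hA), lintegral_indicator_one (cone_meas hB),
    lintegral_indicator_one Metric.isClosed_closedBall.measurableSet,
    Measure.addHaar_closedBall _ _ (Real.sqrt_nonneg R), finrank_euclideanSpace_fin, ← hV,
    mul_pow, ← ENNReal.ofReal_pow (by positivity), ← pow_mul, mul_comm n, pow_mul,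
    Real.sq_sqrt (by linarith)] at hPL
  rw [coneMeasure_apply hA, coneMeasure_apply hB, ← hV]
  calc 4 ^ n * (V⁻¹ * volume (cone A) * (V⁻¹ * volume (cone B)))
      = 4 ^ n * (volume (cone A) * volume (cone B)) * (V⁻¹ * V⁻¹) := by ring
    _ ≤ ENNReal.ofReal (R ^ n) * V ^ 2 * (V⁻¹ * V⁻¹) := by gcongr
    _ = ENNReal.ofReal (R ^ n) * ((V * V⁻¹) * (V * V⁻¹)) := by ring
    _ = ENNReal.ofReal (R ^ n) := by rw [ENNReal.mul_inv_cancel hV₀ hV_top]; simp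

theorem max_one_four_sub_sq_div_four_pow_le {n : ℕ} {γ : ℝ} (hγ₀ : 0 ≤ γ) (hγ₂ : γ ≤ 2) :
    (max 1 (4 - γ ^ 2) / 4) ^ n ≤ Real.exp (-((n : ℝ) - 1) * γ ^ 2 / 4) := by
  have hbase : max 1 (4 - γ ^ 2) / 4 ≤ Real.exp (-(γ ^ 2 / 4)) := by
    rw [div_le_iff₀ (by norm_num), max_le_iff]
    constructor
    · have h₁ : Real.exp (-1) ≤ Real.exp (-(γ ^ 2 / 4)) := Real.exp_le_exp.2 (by nlinarith)
      have h₂ : (1 / 4 : ℝ) ≤ Real.exp (-1) := by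
        rw [Real.exp_neg, ← one_div]
        exact one_div_le_one_div_of_le (Real.exp_pos 1) (by linarith [Real.exp_one_lt_d9])
      linarith
    · linarith [Real.add_one_le_exp (-(γ ^ 2 / 4))]
  calc (max 1 (4 - γ ^ 2) / 4) ^ n ≤ Real.exp (-(γ ^ 2 / 4)) ^ n := by gcongr
    _ = Real.exp (n * -(γ ^ 2 / 4)) := (Real.exp_nat_mul _ _).symm
    _ ≤ Real.exp (-((n : ℝ) - 1) * γ ^ 2 / 4) := Real.exp_le_exp.2 (by nlinarith [sq_nonneg γ])

theorem stmt16 {n : ℕ} (hn : 2 ≤ n)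
    (σ : Measure (EuclideanSpace ℝ (Fin n))) (hσ : IsUniformSphereMeasure σ)
    (A : Set (EuclideanSpace ℝ (Fin n))) (hA : MeasurableSet A)
    (hAs : A ⊆ Metric.sphere (0 : EuclideanSpace ℝ (Fin n)) 1)
    (γ : ℝ) (hγ : 0 < γ) :
    (σ A).toReal * (1 - (σ (sphExt A γ)).toReal) ≤
      Real.exp (-((n : ℝ) - 1) * γ ^ 2 / 4) := by
  have := hσ.prob
  have hn₀ : n ≠ 0 := by omega
  rcases A.eq_empty_or_nonempty with rfl | hA₀
  · simpa using (Real.exp_pos _).le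
  set B : Set (EuclideanSpace ℝ (Fin n)) :=
    Metric.sphere 0 1 ∩ {ξ | γ ≤ Metric.infDist ξ A}
  have hBm : MeasurableSet B := Metric.isClosed_sphere.measurableSet.inter
    (measurableSet_le measurable_const (Metric.continuous_infDist_pt A).measurable)
  have hsep : ∀ a ∈ A, ∀ b ∈ B, γ ≤ ‖a - b‖ := by
    intro a ha b hb
    rw [← dist_eq_norm, dist_comm]
    exact hb.2.trans (Metric.infDist_le_dist_of_mem ha)
  have hcover : 1 - (σ (sphExt A γ)).toReal ≤ (σ B).toReal := by
    have hsub : Metric.sphere 0 1 ⊆ sphExt A γ ∪ B := by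
      intro ξ hξ
      by_cases h : γ ≤ Metric.infDist ξ A
      · exact Or.inr ⟨hξ, h⟩
      · obtain ⟨η, hη, hd⟩ := (Metric.infDist_lt_iff hA₀).1 (not_le.1 h)
        exact Or.inl ⟨by simpa using hξ, η, hη, by rw [← dist_eq_norm]; exact hd.le⟩
    have h₁ : (1 : ENNReal) ≤ σ (sphExt A γ) + σ B :=
      hσ.sphere.symm.le.trans ((measure_mono hsub).trans (measure_union_le _ _))
    have h₂ := ENNReal.toReal_mono (by finiteness) h₁
    rw [ENNReal.toReal_add (by finiteness) (by finiteness), ENNReal.toReal_one] at h₂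
    linarith
  refine (mul_le_mul_of_nonneg_left hcover ENNReal.toReal_nonneg).trans ?_
  rcases B.eq_empty_or_nonempty with hB₀ | ⟨b, hb⟩
  · simpa [hB₀] using (Real.exp_pos _).le
  obtain ⟨a, ha⟩ := hA₀
  have hγ₂ : γ ≤ 2 := by
    have h₁ : ‖a‖ = 1 := by simpa using hAs ha
    have h₂ : ‖b‖ = 1 := by simpa using hb.1
    linarith [hsep a ha b hb, norm_sub_le a b]
  have hmain := four_pow_mul_coneMeasure_mul_le hn₀ hA hBm hAs Set.inter_subset_left hγ.le hsep
    (le_max_left 1 (4 - γ ^ 2)) (le_max_right 1 (4 - γ ^ 2))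
  rw [← hσ.unique (isUniformSphereMeasure_coneMeasure hn₀)] at hmain
  have hreal := ENNReal.toReal_mono ENNReal.ofReal_ne_top hmain
  rw [ENNReal.toReal_ofReal (by positivity), ENNReal.toReal_mul, ENNReal.toReal_mul,
    ENNReal.toReal_pow, ENNReal.toReal_ofNat] at hreal
  refine le_trans ?_ (max_one_four_sub_sq_div_four_pow_le hγ.le hγ₂)
  rw [div_pow, le_div_iff₀ (by positivity)]
  linarith
end
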